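/- Let 0 < α ≤ 1/2, n ∈ ℕ and ℓ ≤ α²n/2500. Let G be an n-vertex properly edge-coloured graph and let G_1,...,G_ℓ be subgraphs of G, each (α, ℓ)-robustly-coloured and with minimum degree at least (1 − α/30)n. Then G contains pairwise edge-disjoint rainbow trees T_1,...,T_ℓ such that for each i, T_i is a spanning tree of G_i. -/

import Mathlib

open scoped Classical

/-- A colouring of edges is proper if edges sharing a vertex get distinct colours. -/
def ProperColoring {V : Type*} (G : SimpleGraph V) (c : Sym2 V → ℕ) : Prop :=
  ∀ ⦃a b b' : V⦄, G.Adj a b → G.Adj a b' → b ≠ b' → c s(a, b) ≠ c s(a, b')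

/-- A set of edges is rainbow if its edges have pairwise distinct colours. -/
def IsRainbow {V : Type*} (c : Sym2 V → ℕ) (E : Set (Sym2 V)) : Prop :=
  Set.InjOn c E

/-- A finite set of edges forms a matching: non-loops, pairwise vertex-disjoint. -/
def IsMatchingSet {V : Type*} (M : Finset (Sym2 V)) : Prop :=
  (∀ e ∈ M, ¬ e.IsDiag) ∧
  ∀ e ∈ M, ∀ f ∈ M, e ≠ f → ∀ v : V, v ∈ e → v ∉ f

/-- A class `U` of colours is `α`-rich in `G`: the edges of `G` with colour in `U`
contain a matching of size at least `α * |V|`. -/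
def RichClass {V : Type*} [Fintype V] (G : SimpleGraph V) (c : Sym2 V → ℕ)
    (α : ℝ) (U : Set ℕ) : Prop :=
  ∃ M : Finset (Sym2 V), ↑M ⊆ G.edgeSet ∧ (∀ e ∈ M, c e ∈ U) ∧
    IsMatchingSet M ∧ α * (Fintype.card V : ℝ) ≤ (M.card : ℝ)

/-- `G` is `α`-well-coloured: its colours can be partitioned into `|V| - 1`
pairwise disjoint `α`-rich classes. -/
def WellColoured {V : Type*} [Fintype V] (G : SimpleGraph V) (c : Sym2 V → ℕ)
    (α : ℝ) : Prop :=
  ∃ U : Fin (Fintype.card V - 1) → Set ℕ,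
    (∀ i j, i ≠ j → Disjoint (U i) (U j)) ∧
    (∀ i, RichClass G c α (U i)) ∧
    (∀ e ∈ G.edgeSet, ∃ i, c e ∈ U i)

/-- A rainbow forest in `G`. -/
def RainbowForest {V : Type*} (G : SimpleGraph V) (c : Sym2 V → ℕ)
    (F : SimpleGraph V) : Prop :=
  F ≤ G ∧ F.IsAcyclic ∧ IsRainbow c F.edgeSet

/-- `G` is `(α, t)`-robustly-coloured: after removing the edges of any `t`
rainbow forests, `G` remains `α`-well-coloured. -/
def RobustlyColoured {V : Type*} [Fintype V] (G : SimpleGraph V) (c : Sym2 V → ℕ)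
    (α : ℝ) (t : ℕ) : Prop :=
  ∀ F : Fin t → SimpleGraph V, (∀ i, RainbowForest G c (F i)) →
    WellColoured (G.deleteEdges (⋃ i, (F i).edgeSet)) c α

namespace RainbowTrees

variable {V : Type*}

/-- A set of vertices which no edge of the graph leaves. -/
def Closed (F : SimpleGraph V) (A : Finset V) : Prop :=
  ∀ ⦃x y⦄, F.Adj x y → x ∈ A → y ∈ A

lemma mem_edgeSet_sup_edge {F : SimpleGraph V} {v w : V} (h : v ≠ w) {e : Sym2 V} :
    e ∈ (F ⊔ SimpleGraph.edge v w).edgeSet ↔ e ∈ F.edgeSet ∨ e = s(v, w) := by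
  simp [SimpleGraph.edgeSet_edge_of_ne h, or_comm]

lemma Closed.reachable {F : SimpleGraph V} {A : Finset V} (hA : Closed F A) {x y : V}
    (h : F.Reachable x y) (hx : x ∈ A) : y ∈ A := by
  obtain ⟨p⟩ := h
  induction p with
  | nil => exact hx
  | cons hadj _ ih => exact ih (hA hadj hx)

/-- In an acyclic graph, the endpoints of an edge are not both reachable from one vertex once
that edge is removed. -/
lemma not_reachable_both {F : SimpleGraph V} (h : F.IsAcyclic) {x y : V} (hxy : F.Adj x y) (r : V)
    (hx : (F.deleteEdges {s(x, y)}).Reachable r x)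
    (hy : (F.deleteEdges {s(x, y)}).Reachable r y) : False :=
  (SimpleGraph.isBridge_iff.1 (SimpleGraph.isAcyclic_iff_forall_adj_isBridge.1 h hxy))
    (hx.symm.trans hy)

lemma reachable_deleteEdges_or {F : SimpleGraph V} {p q r z : V} (h : F.Reachable r z) :
    (F.deleteEdges {s(p, q)}).Reachable r z ∨ (F.deleteEdges {s(p, q)}).Reachable r p ∨
      (F.deleteEdges {s(p, q)}).Reachable r q := by
  rw [SimpleGraph.reachable_iff_reflTransGen] at h
  induction h with
  | refl => exact Or.inl (SimpleGraph.Reachable.refl _)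
  | @tail x y _ hxy ih =>
    rcases ih with ih | ih
    · by_cases he : s(x, y) = s(p, q)
      · rcases Sym2.eq_iff.1 he with ⟨rfl, rfl⟩ | ⟨rfl, rfl⟩
        · exact Or.inr (Or.inl ih)
        · exact Or.inr (Or.inr ih)
      · refine Or.inl (ih.trans (SimpleGraph.Adj.reachable ?_))
        simpa using ⟨hxy, by simpa using he⟩
    · exact Or.inr ih

lemma exists_parent {F : SimpleGraph V} {r u : V} (h : F.Reachable r u) (hne : u ≠ r) :
    ∃ t, F.Adj u t ∧ F.dist r t < F.dist r u := by
  obtain ⟨p, hp⟩ := h.symm.exists_walk_length_eq_dist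
  cases p with
  | nil => exact absurd rfl hne
  | @cons _ t _ hadj q =>
    refine ⟨t, hadj, ?_⟩
    rw [SimpleGraph.dist_comm (u := r) (v := u), ← hp, SimpleGraph.dist_comm,
      SimpleGraph.Walk.length_cons]
    exact Nat.lt_succ_of_le (SimpleGraph.dist_le q)

variable [Fintype V]

/-- The finset of edges of a graph. -/
noncomputable def edges (F : SimpleGraph V) : Finset (Sym2 V) :=
  Finset.univ.filter (· ∈ F.edgeSet)

/-- The number of neighbours of a vertex. -/
noncomputable def deg (F : SimpleGraph V) (v : V) : ℕ :=
  (Finset.univ.filter (F.Adj v)).card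

@[simp] lemma mem_edges {F : SimpleGraph V} {e : Sym2 V} : e ∈ edges F ↔ e ∈ F.edgeSet := by
  simp [edges]

lemma deg_mono {F F' : SimpleGraph V} (h : F ≤ F') (v : V) : deg F v ≤ deg F' v := by
  apply Finset.card_le_card
  intro w
  simpa using fun hw => h hw

lemma deg_sup_edge_le (F : SimpleGraph V) (v w u : V) :
    deg (F ⊔ SimpleGraph.edge v w) u ≤ deg F u + 1 := by
  unfold deg
  let t : V := if u = v then w else v
  refine le_trans (Finset.card_le_card (t := insert t (Finset.univ.filter (F.Adj u))) ?_)
    (Finset.card_insert_le _ _)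
  intro x
  simp only [Finset.mem_filter, Finset.mem_univ, true_and, SimpleGraph.sup_adj,
    SimpleGraph.edge_adj, Finset.mem_insert, t]
  split_ifs <;> grind

lemma deg_sup_edge_of_ne (F : SimpleGraph V) {v w u : V} (hv : u ≠ v) (hw : u ≠ w) :
    deg (F ⊔ SimpleGraph.edge v w) u = deg F u := by
  unfold deg
  congr 1
  ext x
  simp [SimpleGraph.edge_adj, hv, hw]

lemma edges_sup_edge {F : SimpleGraph V} {v w : V} (h : v ≠ w) :
    edges (F ⊔ SimpleGraph.edge v w) = insert s(v, w) (edges F) := by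
  ext e
  rw [mem_edges, mem_edgeSet_sup_edge h]
  simp [or_comm]

lemma edges_deleteEdges (F : SimpleGraph V) (f : Sym2 V) :
    edges (F.deleteEdges {f}) = (edges F).erase f := by
  ext e
  simp [and_comm]

lemma card_edges_add_one_le [Nonempty V] {F : SimpleGraph V} (h : F.IsAcyclic) :
    (edges F).card + 1 ≤ Fintype.card V := by
  obtain ⟨T, hFT, -, hT⟩ := (SimpleGraph.connected_top (V := V)).exists_isTree_le_of_le_of_isAcyclic
    le_top h
  rw [← hT.card_edgeFinset]
  gcongr
  intro e
  simpa using fun he => SimpleGraph.edgeSet_mono hFT he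

lemma edges_induce (F : SimpleGraph V) (A : Finset V) :
    (edges F).filter (fun e => ∀ x ∈ e, x ∈ A) =
      (edges (F.induce (A : Set V))).image (Sym2.map Subtype.val) := by
  ext e
  induction e with | h x y =>
  simp only [Finset.mem_filter, mem_edges, SimpleGraph.mem_edgeSet, Sym2.mem_iff, Finset.mem_image]
  constructor
  · rintro ⟨h, hA⟩
    exact ⟨s(⟨x, hA x (Or.inl rfl)⟩, ⟨y, hA y (Or.inr rfl)⟩), by simpa using h, rfl⟩
  · rintro ⟨e, he, h⟩
    induction e with | h a b =>
    have ha : a.1 ∈ A := a.2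
    have hb : b.1 ∈ A := b.2
    have hab : F.Adj a b := by simpa using he
    simp only [Sym2.map_mk, Sym2.eq_iff] at h
    rcases h with ⟨rfl, rfl⟩ | ⟨rfl, rfl⟩
    · exact ⟨hab, by rintro x (rfl | rfl) <;> assumption⟩
    · exact ⟨hab.symm, by rintro x (rfl | rfl) <;> assumption⟩

lemma card_edges_inside {F : SimpleGraph V} (h : F.IsAcyclic) {A : Finset V} (hA : A.Nonempty) :
    ((edges F).filter (fun e => ∀ x ∈ e, x ∈ A)).card + 1 ≤ A.card := by
  rw [edges_induce, Finset.card_image_of_injective _ (Sym2.map.injective Subtype.val_injective)]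
  obtain ⟨a, ha⟩ := hA
  have : Nonempty (A : Set V) := ⟨⟨a, ha⟩⟩
  simpa using card_edges_add_one_le (h.induce (A : Set V))

lemma sum_deg (F : SimpleGraph V) : ∑ v, deg F v = 2 * (edges F).card := by
  have h := F.sum_degrees_eq_twice_card_edges
  convert h using 2 with v
  · unfold deg
    rw [← SimpleGraph.card_neighborFinset_eq_degree]
    congr 1
    ext w
    simp
  · congr 1
    ext e
    simp

lemma exists_deg_le_one {F : SimpleGraph V} (h : F.IsAcyclic) {A : Finset V} (hA : A.Nonempty)
    (hcl : Closed F A) : ∃ v ∈ A, deg F v ≤ 1 := by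
  by_contra! hc
  obtain ⟨a, ha⟩ := hA
  have : Nonempty (A : Set V) := ⟨⟨a, ha⟩⟩
  have h1 := card_edges_add_one_le (h.induce (A : Set V))
  have h2 := sum_deg (F.induce (A : Set V))
  have h3 : ∀ v : (A : Set V), 2 ≤ deg (F.induce (A : Set V)) v := by
    intro v
    refine le_trans (hc v v.2) ?_
    unfold deg
    rw [← Finset.card_map (Function.Embedding.subtype (· ∈ (A : Set V)))]
    apply Finset.card_le_card
    intro w
    simp only [Finset.mem_filter, Finset.mem_univ, true_and, Finset.mem_map]
    intro hw
    exact ⟨⟨w, hcl hw v.2⟩, by simpa using hw, rfl⟩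
  have h4 : ∑ _v : (A : Set V), 2 ≤ ∑ v, deg (F.induce (A : Set V)) v :=
    Finset.sum_le_sum fun v _ => h3 v
  simp only [Finset.sum_const, Finset.card_univ, smul_eq_mul] at h4
  omega

/-- The vertices which the removal of the edge `f` separates from `r`. -/
noncomputable def cutOff (F : SimpleGraph V) (r : V) (f : Sym2 V) : Finset V :=
  Finset.univ.filter fun u => F.Reachable r u ∧ ¬ (F.deleteEdges {f}).Reachable r u

lemma mem_cutOff {F : SimpleGraph V} {r : V} {f : Sym2 V} {u : V} :
    u ∈ cutOff F r f ↔ F.Reachable r u ∧ ¬ (F.deleteEdges {f}).Reachable r u := by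
  simp [cutOff]

lemma closed_cutOff (F : SimpleGraph V) (r : V) (f : Sym2 V) :
    Closed (F.deleteEdges {f}) (cutOff F r f) := by
  intro x y hxy hx
  rw [mem_cutOff] at hx ⊢
  exact ⟨hx.1.trans (SimpleGraph.deleteEdges_le _ hxy).reachable,
    fun hy => hx.2 (hy.trans hxy.symm.reachable)⟩

lemma cutOff_ssubset {F : SimpleGraph V} {r : V} {f : Sym2 V} {p q : V}
    (hp : p ∈ cutOff F r f) (hq : q ∈ cutOff F r f) :
    cutOff F r s(p, q) ⊂ cutOff F r f := by
  rw [mem_cutOff] at hp hq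
  refine ⟨fun u hu => ?_, fun hss => ?_⟩
  · rw [mem_cutOff] at hu ⊢
    refine ⟨hu.1, fun h => hu.2 ?_⟩
    rw [SimpleGraph.reachable_iff_reflTransGen] at h
    induction h with
    | refl => exact SimpleGraph.Reachable.refl _
    | @tail x y hx hxy ih =>
      rw [← SimpleGraph.reachable_iff_reflTransGen] at hx
      have hx' : F.Reachable r x := hx.mono (SimpleGraph.deleteEdges_le _)
      have hy := hx.trans hxy.reachable
      by_cases hrx : (F.deleteEdges {s(p, q)}).Reachable r x
      · refine hrx.trans (SimpleGraph.Adj.reachable ?_)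
        simp only [SimpleGraph.deleteEdges_adj, Set.mem_singleton_iff] at hxy ⊢
        refine ⟨hxy.1, fun he => ?_⟩
        rcases Sym2.eq_iff.1 he with ⟨rfl, rfl⟩ | ⟨rfl, rfl⟩
        · exact hp.2 hx
        · exact hq.2 hx
      · exact absurd (ih ⟨hx', hrx⟩) hrx
  · have h1 := (mem_cutOff.1 (hss (mem_cutOff.2 hp))).2
    have h2 := (mem_cutOff.1 (hss (mem_cutOff.2 hq))).2
    rcases reachable_deleteEdges_or (p := p) (q := q) hp.1 with h | h | h
    exacts [h1 h, h1 h, h2 h]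

lemma card_le_edges_inside {F : SimpleGraph V} {r : V} {Y : Finset V} (a : V)
    (hY : ∀ u ∈ Y, u ≠ a → F.Reachable r u ∧ u ≠ r ∧ ∀ t, F.Adj u t → t ∈ Y) :
    Y.card ≤ ((edges F).filter (fun e => ∀ x ∈ e, x ∈ Y)).card + 1 := by
  have hpar : ∀ u, ∃ t, u ∈ Y → u ≠ a → F.Adj u t ∧ F.dist r t < F.dist r u := by
    intro u
    by_cases hu : u ∈ Y ∧ u ≠ a
    · obtain ⟨t, ht⟩ := exists_parent (hY u hu.1 hu.2).1 (hY u hu.1 hu.2).2.1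
      exact ⟨t, fun _ _ => ht⟩
    · exact ⟨u, fun h h' => absurd ⟨h, h'⟩ hu⟩
  choose π hπ using hpar
  have key : (Y.erase a).card ≤ ((edges F).filter (fun e => ∀ x ∈ e, x ∈ Y)).card := by
    refine Finset.card_le_card_of_injOn (fun u => s(u, π u)) ?_ ?_
    · intro u hu
      simp only [Finset.coe_erase, Set.mem_sdiff, Finset.mem_coe, Set.mem_singleton_iff] at hu
      have h := (hπ u hu.1 hu.2).1
      simp only [Finset.coe_filter, mem_edges, Set.mem_ofPred_eq, SimpleGraph.mem_edgeSet,
        Sym2.mem_iff]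
      refine ⟨h, ?_⟩
      rintro x (rfl | rfl)
      exacts [hu.1, (hY u hu.1 hu.2).2.2 _ h]
    · intro u hu w hw huw
      simp only [Finset.coe_erase, Set.mem_sdiff, Finset.mem_coe, Set.mem_singleton_iff] at hu hw
      have h1 := (hπ u hu.1 hu.2).2
      have h2 := (hπ w hw.1 hw.2).2
      rcases Sym2.eq_iff.1 huw with ⟨h, -⟩ | ⟨h, h'⟩
      · exact h
      · rw [h'] at h1
        rw [← h] at h2
        omega
  have := Finset.pred_card_le_card_erase (s := Y) (a := a)
  omega

lemma card_cutOff_le {F : SimpleGraph V} (r : V) (f : Sym2 V) :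
    (cutOff F r f).card ≤
      ((edges F).filter (fun e => ∀ x ∈ e, x ∈ cutOff F r f)).card + 1 := by
  have hr : ∀ u ∈ cutOff F r f, u ≠ r := by
    rintro u hu rfl
    exact (mem_cutOff.1 hu).2 (SimpleGraph.Reachable.refl _)
  have hout : ∀ {u t}, u ∈ cutOff F r f → F.Adj u t → t ∉ cutOff F r f → s(u, t) = f := by
    intro u t hu hut ht
    by_contra he
    exact ht (closed_cutOff F r f (by simpa using ⟨hut, he⟩) hu)
  by_cases ha : ∃ a ∈ cutOff F r f, ∃ b, F.Adj a b ∧ b ∉ cutOff F r f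
  · obtain ⟨a, ha, b, hab, hb⟩ := ha
    refine card_le_edges_inside (r := r) a fun u hu hne =>
      ⟨(mem_cutOff.1 hu).1, hr u hu, fun t hut => ?_⟩
    by_contra ht
    rcases Sym2.eq_iff.1 ((hout hu hut ht).trans (hout ha hab hb).symm) with ⟨h, -⟩ | ⟨h, -⟩
    · exact hne h
    · exact hb (h ▸ hu)
  · push Not at ha
    exact card_le_edges_inside r fun u hu hne =>
      ⟨(mem_cutOff.1 hu).1, hne, fun t hut => ha u hu t hut⟩

/-- A component of a forest with more than `s` vertices has at least `s` edges each of which cuts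
off at most `s` vertices from a given vertex `r`. -/
lemma exists_small_cutOffs (F : SimpleGraph V) (r : V) (s : ℕ)
    (hs : s < (Finset.univ.filter (F.Reachable r)).card) :
    ∃ E ⊆ edges F, s ≤ E.card ∧ ∀ f ∈ E, (cutOff F r f).card ≤ s ∧ ∀ x ∈ f, F.Reachable r x := by
  by_cases hbig : ∃ f ∈ edges F, s < (cutOff F r f).card
  · obtain ⟨f, hf, hmin⟩ := Finset.exists_min_image
      ((edges F).filter fun f => s < (cutOff F r f).card) (fun f => (cutOff F r f).card)
      (by obtain ⟨f, hf, h⟩ := hbig; exact ⟨f, by simp [h]; simpa using hf⟩)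
    simp only [Finset.mem_filter] at hf hmin
    refine ⟨_, Finset.filter_subset (fun e => ∀ x ∈ e, x ∈ cutOff F r f) _, ?_, ?_⟩
    · have := card_cutOff_le (F := F) r f
      omega
    · intro e he
      rw [Finset.mem_filter] at he
      obtain ⟨heF, he⟩ := he
      refine ⟨?_, fun x hx => (mem_cutOff.1 (he x hx)).1⟩
      by_contra! hlt
      have h1 := hmin e ⟨heF, hlt⟩
      induction e with | h p q =>
      have h2 := Finset.card_lt_card (cutOff_ssubset (he p (by simp)) (he q (by simp)))
      omega
  · push Not at hbig
    refine ⟨_, Finset.filter_subset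
      (fun e => ∀ x ∈ e, x ∈ Finset.univ.filter (F.Reachable r)) _, ?_, ?_⟩
    · have := card_le_edges_inside (F := F) (r := r) (Y := Finset.univ.filter (F.Reachable r)) r
        fun u hu hne => ?_
      · omega
      · simp only [Finset.mem_filter, Finset.mem_univ, true_and] at hu ⊢
        exact ⟨hu, hne, fun t ht => hu.trans ht.reachable⟩
    · intro e he
      rw [Finset.mem_filter] at he
      exact ⟨hbig e he.1, fun x hx => by simpa using he.2 x hx⟩

/-- A rainbow forest in `H` of maximum degree at most `K`. -/
structure LowForest (H : SimpleGraph V) (c : Sym2 V → ℕ) (K : ℕ) (F : SimpleGraph V) : Prop where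
  le : F ≤ H
  acyclic : F.IsAcyclic
  rainbow : IsRainbow c F.edgeSet
  deg_le : ∀ v, deg F v ≤ K

/-- A forest `F` with the maximum number of edges together with a proper nonempty closed set `A`
which is smallest over all such forests. -/
structure Extremal (H : SimpleGraph V) (c : Sym2 V → ℕ) (K : ℕ) (F : SimpleGraph V)
    (A : Finset V) : Prop where
  forest : LowForest H c K F
  closed : Closed F A
  nonempty : A.Nonempty
  ne_univ : A ≠ Finset.univ
  max : ∀ F', LowForest H c K F' → (edges F').card ≤ (edges F).card
  min : ∀ F' A', LowForest H c K F' → (edges F').card = (edges F).card → Closed F' A' →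
    A'.Nonempty → A' ≠ Finset.univ → A.card ≤ A'.card

variable {H : SimpleGraph V} {c : Sym2 V → ℕ} {K : ℕ} {F : SimpleGraph V} {A : Finset V}

lemma LowForest.deleteEdges (hF : LowForest H c K F) (f : Sym2 V) :
    LowForest H c K (F.deleteEdges {f}) where
  le := (SimpleGraph.deleteEdges_le _).trans hF.le
  acyclic := hF.acyclic.anti (SimpleGraph.deleteEdges_le _)
  rainbow := hF.rainbow.mono (SimpleGraph.edgeSet_mono (SimpleGraph.deleteEdges_le _))
  deg_le v := (deg_mono (SimpleGraph.deleteEdges_le _) v).trans (hF.deg_le v)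

lemma LowForest.sup_edge (hF : LowForest H c K F) {v w : V} (hv : deg F v < K) (hw : deg F w < K)
    (hH : H.Adj v w) (hr : ¬ F.Reachable v w) (hc : ∀ e ∈ F.edgeSet, c e ≠ c s(v, w)) :
    LowForest H c K (F ⊔ SimpleGraph.edge v w) where
  le := sup_le hF.le (by rw [SimpleGraph.edge_le_iff]; exact Or.inr hH)
  acyclic := hF.acyclic.sup_edge_of_not_reachable hr
  rainbow := by
    intro e he e' he' hee
    rw [mem_edgeSet_sup_edge hH.ne] at he he'
    rcases he with he | rfl <;> rcases he' with he' | rfl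
    · exact hF.rainbow he he' hee
    · exact absurd hee (hc e he)
    · exact absurd hee.symm (hc e' he')
    · rfl
  deg_le u := by
    by_cases huv : u = v
    · have := deg_sup_edge_le F v w u
      subst huv; omega
    by_cases huw : u = w
    · have := deg_sup_edge_le F v w u
      subst huw; omega
    rw [deg_sup_edge_of_ne F huv huw]
    exact hF.deg_le u

lemma card_edges_sup_edge {v w : V} (hr : ¬ F.Reachable v w) :
    (edges (F ⊔ SimpleGraph.edge v w)).card = (edges F).card + 1 := by
  have hne : v ≠ w := by
    rintro rfl
    exact hr (SimpleGraph.Reachable.refl _)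
  rw [edges_sup_edge hne, Finset.card_insert_of_notMem]
  simpa using fun h : F.Adj v w => hr h.reachable

lemma card_edges_deleteEdges {f : Sym2 V} (hf : f ∈ F.edgeSet) :
    (edges (F.deleteEdges {f})).card + 1 = (edges F).card := by
  rw [edges_deleteEdges, Finset.card_erase_add_one (by simpa using hf)]

omit [Fintype V] in
lemma Closed.deleteEdges (hA : Closed F A) (s : Set (Sym2 V)) : Closed (F.deleteEdges s) A :=
  fun _ _ h => hA (SimpleGraph.deleteEdges_le _ h)

omit [Fintype V] in
lemma Closed.sup_edge (hA : Closed F A) {v w : V} (h : v ∈ A ↔ w ∈ A) :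
    Closed (F ⊔ SimpleGraph.edge v w) A := by
  intro x y hxy hx
  simp only [SimpleGraph.sup_adj, SimpleGraph.edge_adj] at hxy
  rcases hxy with hxy | ⟨⟨rfl, rfl⟩ | ⟨rfl, rfl⟩, -⟩
  exacts [hA hxy hx, h.1 hx, h.2 hx]

omit [Fintype V] in
lemma Closed.not_reachable (hA : Closed F A) {v w : V} (hv : v ∈ A) (hw : w ∉ A) :
    ¬ F.Reachable v w := fun h => hw (hA.reachable h hv)

lemma LowForest.swap (hF : LowForest H c K F) {f : Sym2 V} {v w : V} (hf : f ∈ F.edgeSet)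
    (hv : deg F v < K) (hw : deg F w < K) (hH : H.Adj v w)
    (hr : ¬ (F.deleteEdges {f}).Reachable v w) (hc : ∀ e ∈ F.edgeSet, e ≠ f → c e ≠ c s(v, w)) :
    LowForest H c K (F.deleteEdges {f} ⊔ SimpleGraph.edge v w) ∧
      (edges (F.deleteEdges {f} ⊔ SimpleGraph.edge v w)).card = (edges F).card := by
  refine ⟨(hF.deleteEdges f).sup_edge ((deg_mono (SimpleGraph.deleteEdges_le _) v).trans_lt hv)
    ((deg_mono (SimpleGraph.deleteEdges_le _) w).trans_lt hw) hH hr ?_, ?_⟩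
  · intro e he
    rw [SimpleGraph.edgeSet_deleteEdges] at he
    exact hc e he.1 he.2
  · rw [card_edges_sup_edge hr, card_edges_deleteEdges hf]

lemma Extremal.exists_color_eq (hE : Extremal H c K F A) {v w : V} (hv : deg F v < K)
    (hw : deg F w < K) (hH : H.Adj v w) (hr : ¬ F.Reachable v w) :
    ∃ f ∈ F.edgeSet, c f = c s(v, w) := by
  by_contra! hc
  have := hE.max _ (hE.forest.sup_edge hv hw hH hr hc)
  rw [card_edges_sup_edge hr] at this
  omega

lemma Extremal.exists_outer_color_eq (hE : Extremal H c K F A) {v w : V} (hvA : v ∈ A)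
    (hwA : w ∉ A) (hv : deg F v < K) (hw : deg F w < K) (hH : H.Adj v w) :
    ∃ f ∈ F.edgeSet, c f = c s(v, w) ∧ ∀ x ∈ f, x ∉ A := by
  obtain ⟨f, hf, hcf⟩ := hE.exists_color_eq hv hw hH (hE.closed.not_reachable hvA hwA)
  refine ⟨f, hf, hcf, fun x hxf hxA => ?_⟩
  have hr := (hE.closed.deleteEdges {f}).not_reachable hvA hwA
  obtain ⟨hS, hcard⟩ := hE.forest.swap hf hv hw hH hr fun e he hne hce =>
    hne (hE.forest.rainbow he hf (hce.trans hcf.symm))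
  have hss : A.filter (fun z => ¬ (F.deleteEdges {f}).Reachable v z) ⊂ A := by
    rw [Finset.filter_ssubset]
    exact ⟨v, hvA, by simp⟩
  refine absurd (hE.min _ (A.filter fun z => ¬ (F.deleteEdges {f}).Reachable v z) hS hcard
    (Closed.sup_edge ?_ (by simp [hwA])) ?_ ?_) (not_le.2 (Finset.card_lt_card hss))
  · intro y z hyz hy
    rw [Finset.mem_filter] at hy ⊢
    exact ⟨hE.closed (SimpleGraph.deleteEdges_le _ hyz) hy.1,
      fun h => hy.2 (h.trans hyz.symm.reachable)⟩
  · obtain ⟨y, rfl⟩ := hxf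
    have hyA := hE.closed hf hxA
    by_cases hx : (F.deleteEdges {s(x, y)}).Reachable v x
    · exact ⟨y, Finset.mem_filter.2 ⟨hyA, fun hy =>
        not_reachable_both hE.forest.acyclic hf v hx hy⟩⟩
    · exact ⟨x, Finset.mem_filter.2 ⟨hxA, hx⟩⟩
  · intro h
    exact hwA (hss.1 (h ▸ Finset.mem_univ w))

lemma Extremal.mem_of_color_eq (hE : Extremal H c K F A) {v w : V} {f : Sym2 V} {Y : Finset V}
    (hvA : v ∈ A) (hwA : w ∉ A) (hv : deg F v < K) (hw : deg F w < K) (hH : H.Adj v w)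
    (hf : f ∈ F.edgeSet) (hcf : c f = c s(v, w)) (hY : Closed (F.deleteEdges {f}) Y)
    (hYne : Y.Nonempty) (hvY : v ∉ Y) (hYA : Y.card < A.card) : w ∈ Y := by
  by_contra hwY
  have hr := (hE.closed.deleteEdges {f}).not_reachable hvA hwA
  obtain ⟨hS, hcard⟩ := hE.forest.swap hf hv hw hH hr fun e he hne hce =>
    hne (hE.forest.rainbow he hf (hce.trans hcf.symm))
  refine absurd (hE.min _ Y hS hcard (hY.sup_edge (by simp [hvY, hwY])) hYne ?_) (not_le.2 hYA)
  intro h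
  exact hvY (h ▸ Finset.mem_univ v)

lemma Extremal.reachable_of_color_eq (hE : Extremal H c K F A) {v w x y : V} {f : Sym2 V}
    (hvA : v ∈ A) (hwA : w ∉ A) (hv : deg F v + 1 < K) (hw : deg F w + 1 < K) (hH : H.Adj v w)
    (hf : f ∈ F.edgeSet) (hcf : c f = c s(v, w)) (hx : deg F x + 1 < K) (hy : deg F y + 1 < K)
    (hxy : H.Adj x y) (hc : ∀ e ∈ F.edgeSet, c e ≠ c s(x, y)) :
    (F.deleteEdges {f}).Reachable x y := by
  by_contra hr
  by_cases hF : F.Reachable x y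
  · obtain ⟨hS, hcard⟩ := hE.forest.swap hf (by omega) (by omega) hxy hr fun e he _ => hc e he
    have hcl : Closed (F.deleteEdges {f} ⊔ SimpleGraph.edge x y) A :=
      (hE.closed.deleteEdges {f}).sup_edge
        ⟨fun h => hE.closed.reachable hF h, fun h => hE.closed.reachable hF.symm h⟩
    have hr' := hcl.not_reachable hvA hwA
    have hdeg : ∀ u, deg F u + 1 < K → deg (F.deleteEdges {f} ⊔ SimpleGraph.edge x y) u < K := by
      intro u hu
      have h1 := deg_sup_edge_le (F.deleteEdges {f}) x y u
      have h2 := deg_mono (SimpleGraph.deleteEdges_le (G := F) {f}) u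
      omega
    have := hE.max _ (hS.sup_edge (hdeg v hv) (hdeg w hw) hH hr' fun e he hce => by
      rw [mem_edgeSet_sup_edge hxy.ne, SimpleGraph.edgeSet_deleteEdges] at he
      rcases he with he | rfl
      · exact he.2 (hE.forest.rainbow he.1 hf (hce.trans hcf.symm))
      · exact hc f hf (hcf.trans hce.symm))
    rw [card_edges_sup_edge hr', hcard] at this
    omega
  · obtain ⟨e, he, hce⟩ := hE.exists_color_eq (v := x) (w := y) (by omega) (by omega) hxy hF
    exact hc e he hce

omit [Fintype V] in
lemma exists_separating_adj (hF : F.IsAcyclic) {x y : V} (hne : x ≠ y) (h : F.Reachable x y) :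
    ∃ t, F.Adj x t ∧ ¬ (F.deleteEdges {s(x, t)}).Reachable x y := by
  obtain ⟨p, hp⟩ := h.exists_isPath
  cases p with
  | nil => exact absurd rfl hne
  | @cons _ t _ hadj q =>
    refine ⟨t, hadj, fun hr => ?_⟩
    rw [SimpleGraph.Walk.cons_isPath_iff] at hp
    refine not_reachable_both hF hadj y hr.symm (SimpleGraph.Reachable.symm ?_)
    by_contra hn
    exact hp.2 (q.fst_mem_support_of_mem_edges (q.mem_edges_of_not_reachable_deleteEdges hn))

lemma exists_extremal (hno : ∀ T, LowForest H c K T → ¬ T.Connected) [Nonempty V] :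
    ∃ F A, Extremal H c K F A := by
  have hbot : LowForest H c K ⊥ :=
    ⟨bot_le, SimpleGraph.isAcyclic_bot, by simp [IsRainbow], by simp [deg]⟩
  obtain ⟨F₀, hF₀, hmax⟩ := Finset.exists_max_image
    (Finset.univ.filter (LowForest H c K)) (fun F => (edges F).card) ⟨⊥, by simpa using hbot⟩
  simp only [Finset.mem_filter, Finset.mem_univ, true_and] at hF₀ hmax
  let P : SimpleGraph V × Finset V → Prop := fun p => LowForest H c K p.1 ∧
    (edges p.1).card = (edges F₀).card ∧ Closed p.1 p.2 ∧ p.2.Nonempty ∧ p.2 ≠ Finset.univ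
  have hP : ∃ p, P p := by
    have h1 : ¬ ∀ x y, F₀.Reachable x y := fun h => hno F₀ hF₀ ⟨h⟩
    push Not at h1
    obtain ⟨x, y, hxy⟩ := h1
    refine ⟨(F₀, Finset.univ.filter (F₀.Reachable x)), hF₀, rfl, ?_, ⟨x, by simp⟩, ?_⟩
    · intro u v huv hu
      simp only [Finset.mem_filter, Finset.mem_univ, true_and] at hu ⊢
      exact hu.trans huv.reachable
    · intro h
      have := h ▸ Finset.mem_univ y
      simp only [Finset.mem_filter, Finset.mem_univ, true_and] at this
      exact hxy this
  obtain ⟨p, hp, hmin⟩ := Finset.exists_min_image (Finset.univ.filter P) (fun p => p.2.card)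
    (by obtain ⟨p, hp⟩ := hP; exact ⟨p, by simpa using hp⟩)
  simp only [Finset.mem_filter, Finset.mem_univ, true_and] at hp hmin
  obtain ⟨h1, h2, h3, h4, h5⟩ := hp
  exact ⟨p.1, p.2, h1, h3, h4, h5, fun F' hF' => h2 ▸ hmax F' hF',
    fun F' A' a b c d e => hmin (F', A') ⟨a, b.trans h2, c, d, e⟩⟩

/-- The vertices whose degree is within one of the bound `K` or exceeds it. -/
noncomputable def saturated (F : SimpleGraph V) (K : ℕ) : Finset V :=
  Finset.univ.filter fun v => K ≤ deg F v + 1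

/-- The edges of `F` avoiding `A`. -/
noncomputable def outer (F : SimpleGraph V) (A : Finset V) : Finset (Sym2 V) :=
  (edges F).filter fun e => ∀ x ∈ e, x ∉ A

/-- The edges of `F` avoiding `A` whose colour appears on an edge of `H` from `v` to an unsaturated
vertex outside `A`. -/
noncomputable def matched (H : SimpleGraph V) (c : Sym2 V → ℕ) (K : ℕ) (F : SimpleGraph V)
    (A : Finset V) (v : V) : Finset (Sym2 V) :=
  (outer F A).filter fun f => ∃ w, w ∉ A ∧ w ∉ saturated F K ∧ H.Adj v w ∧ c f = c s(v, w)

lemma notMem_saturated {v : V} : v ∉ saturated F K ↔ deg F v + 1 < K := by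
  simp [saturated]

lemma card_saturated_le [Nonempty V] (h : F.IsAcyclic) :
    (saturated F K).card * (K - 1) ≤ 2 * Fintype.card V := by
  have h1 : ∑ _v ∈ saturated F K, (K - 1) ≤ ∑ v ∈ saturated F K, deg F v := by
    refine Finset.sum_le_sum fun v hv => ?_
    simp only [saturated, Finset.mem_filter] at hv
    omega
  have h2 : ∑ v ∈ saturated F K, deg F v ≤ ∑ v, deg F v :=
    Finset.sum_le_sum_of_subset (Finset.subset_univ _)
  have h3 := sum_deg F
  have h4 := card_edges_add_one_le h
  simp only [Finset.sum_const, smul_eq_mul] at h1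
  omega

lemma Extremal.compl_nonempty (hE : Extremal H c K F A) : Aᶜ.Nonempty := by
  rw [Finset.nonempty_iff_ne_empty, Ne, Finset.compl_eq_empty_iff]
  exact hE.ne_univ

lemma Extremal.card_outer (hE : Extremal H c K F A) :
    (outer F A).card + A.card + 1 ≤ Fintype.card V := by
  have h1 := card_edges_inside hE.forest.acyclic hE.compl_nonempty
  have h2 := Finset.card_add_card_compl A
  have h3 : (edges F).filter (fun e => ∀ x ∈ e, x ∈ Aᶜ) = outer F A := by
    simp [outer]
  rw [h3] at h1
  omega

lemma Extremal.card_sdiff_le (hE : Extremal H c K F A) (B : Finset (Sym2 V)) :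
    (edges F \ B).card + 1 ≤ (outer F A \ B).card + A.card := by
  have h1 := card_edges_inside hE.forest.acyclic hE.nonempty
  have h2 : edges F \ B ⊆ (outer F A \ B) ∪ (edges F).filter (fun e => ∀ x ∈ e, x ∈ A) := by
    intro e he
    rw [Finset.mem_sdiff] at he
    obtain ⟨heF, heB⟩ := he
    simp only [Finset.mem_union, Finset.mem_sdiff, outer, Finset.mem_filter, heF, heB, true_and,
      not_false_eq_true, and_true]
    induction e with | h x y =>
    have hxy : F.Adj x y := by simpa using heF
    by_cases hx : x ∈ A
    · exact Or.inr (by simpa using ⟨hx, hE.closed hxy hx⟩)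
    · exact Or.inl (by simpa using ⟨hx, fun hy => hx (hE.closed hxy.symm hy)⟩)
  have h3 := (Finset.card_le_card h2).trans (Finset.card_union_le _ _)
  omega

lemma Extremal.card_edges (hE : Extremal H c K F A) : (edges F).card + 2 ≤ Fintype.card V := by
  have h1 := hE.card_sdiff_le ∅
  have h2 := hE.card_outer
  simp only [Finset.sdiff_empty] at h1
  omega

lemma Extremal.card_outer_sdiff_matched (hE : Extremal H c K F A) (hp : ProperColoring H c)
    {v : V} (hvA : v ∈ A) (hv : v ∉ saturated F K) :
    (outer F A \ matched H c K F A v).card + deg H v + 1 ≤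
      Fintype.card V + (saturated F K).card := by
  have hsub : matched H c K F A v ⊆ outer F A := Finset.filter_subset _ _
  let W : Finset V := (Finset.univ.filter (H.Adj v)) \ (A ∪ saturated F K)
  have hW : W.card ≤ (matched H c K F A v).card := by
    have hex : ∀ w, ∃ f, w ∈ W → f ∈ outer F A ∧ c f = c s(v, w) := by
      intro w
      by_cases hw : w ∈ W
      · simp only [W, Finset.mem_sdiff, Finset.mem_filter, Finset.mem_univ, true_and,
          Finset.mem_union, not_or] at hw
        rw [notMem_saturated] at hv
        have hw2 := notMem_saturated.1 hw.2.2
        obtain ⟨f, hf, hcf, hfA⟩ := hE.exists_outer_color_eq hvA hw.2.1 (by omega) (by omega) hw.1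
        exact ⟨f, fun _ => ⟨by simpa [outer] using ⟨hf, hfA⟩, hcf⟩⟩
      · exact ⟨s(v, v), fun h => absurd h hw⟩
    choose φ hφ using hex
    refine Finset.card_le_card_of_injOn φ ?_ ?_
    · intro w hw
      obtain ⟨h1, h2⟩ := hφ w hw
      simp only [W, Finset.coe_sdiff, Set.mem_sdiff, Finset.mem_coe, Finset.mem_filter,
        Finset.mem_univ, true_and, Finset.mem_union, not_or] at hw
      exact Finset.mem_filter.2 ⟨h1, w, hw.2.1, hw.2.2, hw.1, h2⟩
    · intro w hw w' hw' hww
      by_contra hne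
      have h1 := (hφ w hw).2
      have h2 := (hφ w' hw').2
      simp only [W, Finset.coe_sdiff, Set.mem_sdiff, Finset.mem_coe, Finset.mem_filter,
        Finset.mem_univ, true_and] at hw hw'
      exact hp hw.1 hw'.1 hne (by rw [← h1, ← h2, hww])
  have hdeg : deg H v ≤ W.card + (A ∪ saturated F K).card := by
    rw [← Nat.sub_le_iff_le_add]
    exact Finset.le_card_sdiff (A ∪ saturated F K) (Finset.univ.filter (H.Adj v))
  have h1 := Finset.card_union_le A (saturated F K)
  have h2 := hE.card_outer
  have h3 := Finset.card_sdiff_add_card_eq_card hsub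
  omega

lemma Extremal.card_filter_mem_matched_le (hE : Extremal H c K F A) (hp : ProperColoring H c)
    {r : V} (hr : r ∉ A) {f : Sym2 V} (hf : f ∈ edges F) (hfr : ∀ x ∈ f, F.Reachable r x)
    (hY : (cutOff F r f).card < A.card) :
    ((A \ saturated F K).filter fun v => f ∈ matched H c K F A v).card ≤
      (cutOff F r f).card := by
  have hYne : (cutOff F r f).Nonempty := by
    induction f with | h p q =>
    by_cases hrp : (F.deleteEdges {s(p, q)}).Reachable r p
    · exact ⟨q, mem_cutOff.2 ⟨hfr q (by simp), fun hq =>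
        not_reachable_both hE.forest.acyclic (by simpa using hf) r hrp hq⟩⟩
    · exact ⟨p, mem_cutOff.2 ⟨hfr p (by simp), hrp⟩⟩
  have hex : ∀ v, ∃ w, v ∈ (A \ saturated F K).filter (fun v => f ∈ matched H c K F A v) →
      w ∈ cutOff F r f ∧ H.Adj v w ∧ c f = c s(v, w) := by
    intro v
    by_cases hv : v ∈ (A \ saturated F K).filter (fun v => f ∈ matched H c K F A v)
    · simp only [Finset.mem_filter, Finset.mem_sdiff, matched] at hv
      obtain ⟨⟨hvA, hvS⟩, -, w, hwA, hwS, hvw, hcf⟩ := hv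
      rw [notMem_saturated] at hvS hwS
      refine ⟨w, fun _ => ⟨hE.mem_of_color_eq hvA hwA (by omega) (by omega) hvw (by simpa using hf)
        hcf (closed_cutOff F r f) hYne (fun hvY => ?_) hY, hvw, hcf⟩⟩
      exact hr (hE.closed.reachable (mem_cutOff.1 hvY).1.symm hvA)
    · exact ⟨v, fun h => absurd h hv⟩
  choose φ hφ using hex
  refine Finset.card_le_card_of_injOn φ (fun v hv => (hφ v hv).1) ?_
  intro v hv v' hv' hvv
  by_contra hne
  obtain ⟨-, h1, h2⟩ := hφ v hv
  obtain ⟨-, h1', h2'⟩ := hφ v' hv'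
  rw [← hvv] at h1' h2'
  refine hp h1.symm h1'.symm hne ?_
  rw [Sym2.eq_swap, ← h2, h2', Sym2.eq_swap]

/-- The closed set of an extremal pair is small. -/
lemma Extremal.card_sdiff_saturated_le (hE : Extremal H c K F A) (hp : ProperColoring H c) {d : ℕ}
    (hd : ∀ v, Fintype.card V ≤ deg H v + d) :
    (A \ saturated F K).card ≤ 4 * (d + (saturated F K).card) + 1 := by
  obtain ⟨r, hr⟩ := hE.compl_nonempty
  rw [Finset.mem_compl] at hr
  set D := A \ saturated F K with hD
  set s := D.card / 2 with hs
  have hDA : D.card ≤ A.card := Finset.card_le_card Finset.sdiff_subset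
  have hA := hE.nonempty.card_pos
  have hcomp : A.card ≤ (Finset.univ.filter (F.Reachable r)).card := by
    refine hE.min F _ hE.forest rfl ?_ ⟨r, by simp⟩ ?_
    · intro u v huv hu
      simp only [Finset.mem_filter, Finset.mem_univ, true_and] at hu ⊢
      exact hu.trans huv.reachable
    · intro h
      obtain ⟨v, hv⟩ := hE.nonempty
      have := h ▸ Finset.mem_univ v
      simp only [Finset.mem_filter, Finset.mem_univ, true_and] at this
      exact hr (hE.closed.reachable this.symm hv)
  obtain ⟨E, hEF, hEs, hEcut⟩ := exists_small_cutOffs F r s (by omega)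
  have hEout : E ⊆ outer F A := by
    intro f hf
    refine Finset.mem_filter.2 ⟨hEF hf, fun x hx hxA => ?_⟩
    exact hr (hE.closed.reachable ((hEcut f hf).2 x hx).symm hxA)
  have hcount := Finset.sum_card_bipartiteAbove_eq_sum_card_bipartiteBelow
    (s := E) (t := D) (fun f v => f ∉ matched H c K F A v)
  have hlow : E.card * (D.card - s) ≤
      ∑ f ∈ E, (D.bipartiteAbove (fun f v => f ∉ matched H c K F A v) f).card := by
    rw [← smul_eq_mul]
    refine Finset.card_nsmul_le_sum _ _ _ fun f hf => ?_
    have h1 := hE.card_filter_mem_matched_le hp hr (hEF hf) (hEcut f hf).2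
      (by have := (hEcut f hf).1; omega)
    have h2 := Finset.card_filter_add_card_filter_not (s := D) (fun v => f ∈ matched H c K F A v)
    have h3 := (hEcut f hf).1
    rw [← hD] at h1
    change _ ≤ (D.filter fun v => f ∉ matched H c K F A v).card
    omega
  have hupp : ∑ v ∈ D, (E.bipartiteBelow (fun f v => f ∉ matched H c K F A v) v).card ≤
      D.card * (d + (saturated F K).card) := by
    rw [← smul_eq_mul]
    refine Finset.sum_le_card_nsmul _ _ _ fun v hv => ?_
    rw [hD, Finset.mem_sdiff] at hv
    have h1 := hE.card_outer_sdiff_matched hp hv.1 hv.2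
    have h2 : E.bipartiteBelow (fun f v => f ∉ matched H c K F A v) v ⊆
        outer F A \ matched H c K F A v := by
      intro f hf
      simp only [Finset.bipartiteBelow, Finset.mem_filter] at hf
      exact Finset.mem_sdiff.2 ⟨hEout hf.1, hf.2⟩
    have h3 := Finset.card_le_card h2
    have h4 := hd v
    omega
  by_contra! hlt
  have h1 : s * (D.card - s) ≤ E.card * (D.card - s) := Nat.mul_le_mul_right _ hEs
  have h2 : s * (D.card - s) ≤ D.card * (d + (saturated F K).card) := by
    rw [hcount] at hlow
    exact h1.trans (hlow.trans hupp)
  have h3 : D.card ≤ 2 * (D.card - s) := by omega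
  have h4 : 2 * (d + (saturated F K).card) + 1 ≤ s := by omega
  have h5 : (2 * (d + (saturated F K).card) + 1) * D.card ≤ s * (2 * (D.card - s)) :=
    Nat.mul_le_mul h4 h3
  nlinarith

omit [Fintype V] in
lemma card_matching_le {M B : Finset (Sym2 V)} (hM : IsMatchingSet M)
    (hB : ∀ e ∈ M, ∀ x ∈ e, ∃ b ∈ B, x ∈ b) : M.card ≤ B.card := by
  have h1 : (M.biUnion Sym2.toFinset).card = ∑ e ∈ M, 2 := by
    rw [Finset.card_biUnion]
    · exact Finset.sum_congr rfl fun e he => Sym2.card_toFinset_of_not_isDiag e (hM.1 e he)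
    · intro e he f hf hne
      refine Finset.disjoint_left.2 ?_
      intro x hx hx'
      rw [Sym2.mem_toFinset] at hx hx'
      exact hM.2 e he f hf hne x hx hx'
  have h2 : (B.biUnion Sym2.toFinset).card ≤ B.card * 2 := by
    refine Finset.card_biUnion_le_card_mul _ _ _ fun b _ => ?_
    rw [Sym2.card_toFinset]
    split_ifs <;> simp
  have h3 : M.biUnion Sym2.toFinset ⊆ B.biUnion Sym2.toFinset := by
    intro x hx
    simp only [Finset.mem_biUnion, Sym2.mem_toFinset] at hx ⊢
    obtain ⟨e, he, hxe⟩ := hx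
    exact hB e he x hxe
  have h4 := Finset.card_le_card h3
  simp only [Finset.sum_const, smul_eq_mul] at h1
  omega

lemma card_filter_meets_le {M : Finset (Sym2 V)} (hM : IsMatchingSet M) (S : Finset V) :
    (M.filter fun e => ∃ x ∈ e, x ∈ S).card ≤ S.card := by
  have hex : ∀ e : Sym2 V, ∃ x, (∃ x ∈ e, x ∈ S) → x ∈ e ∧ x ∈ S := by
    intro e
    by_cases he : ∃ x ∈ e, x ∈ S
    · obtain ⟨x, hx⟩ := he
      exact ⟨x, fun _ => hx⟩
    · exact ⟨e.out.1, fun h => absurd h he⟩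
  choose φ hφ using hex
  refine Finset.card_le_card_of_injOn φ (fun e he => (hφ e (Finset.mem_filter.1 he).2).2) ?_
  intro e he e' he' hee
  by_contra hne
  simp only [Finset.coe_filter, Set.mem_ofPred_eq] at he he'
  exact hM.2 e he.1 e' he'.1 hne _ (hφ e he.2).1 (hee ▸ (hφ e' he'.2).1)

lemma Extremal.card_new_matching_le (hE : Extremal H c K F A) (hp : ProperColoring H c) {d : ℕ}
    (hd : ∀ v, Fintype.card V ≤ deg H v + d) (hK : 3 ≤ K) {M : Finset (Sym2 V)}
    (hM : IsMatchingSet M) (hMH : ↑M ⊆ H.edgeSet) (hMc : ∀ e ∈ M, ∀ f ∈ F.edgeSet, c f ≠ c e) :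
    M.card ≤ A.card + d + 2 * (saturated F K).card := by
  obtain ⟨v, hvA, hv⟩ := exists_deg_le_one hE.forest.acyclic hE.nonempty hE.closed
  have hvS : v ∉ saturated F K := notMem_saturated.2 (by omega)
  have h1 := hE.card_outer_sdiff_matched hp hvA hvS
  have h2 := hE.card_sdiff_le (matched H c K F A v)
  have h3 := card_filter_meets_le hM (saturated F K)
  have h4 := Finset.card_filter_add_card_filter_not (s := M)
    (fun e => ∃ x ∈ e, x ∈ saturated F K)
  have hend : ∀ x y, s(x, y) ∈ M → x ∉ saturated F K → y ∉ saturated F K →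
      ∃ b ∈ edges F \ matched H c K F A v, x ∈ b := by
    intro x y hxy hx hy
    have hH : H.Adj x y := hMH hxy
    rw [notMem_saturated] at hx hy hvS
    have hr : F.Reachable x y := by
      by_contra hr
      obtain ⟨f, hf, hcf⟩ := hE.exists_color_eq (by omega) (by omega) hH hr
      exact hMc _ hxy f hf hcf
    obtain ⟨t, hxt, hn⟩ := exists_separating_adj hE.forest.acyclic hH.ne hr
    refine ⟨s(x, t), Finset.mem_sdiff.2 ⟨by simpa using hxt, fun hm => hn ?_⟩, by simp⟩
    obtain ⟨-, w, hwA, hwS, hvw, hc⟩ := Finset.mem_filter.1 hm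
    rw [notMem_saturated] at hwS
    exact hE.reachable_of_color_eq hvA hwA hvS hwS hvw hxt hc hx hy hH (hMc _ hxy)
  have h5 : (M.filter fun e => ¬ ∃ x ∈ e, x ∈ saturated F K).card ≤
      (edges F \ matched H c K F A v).card := by
    apply card_matching_le
    · exact ⟨fun e he => hM.1 e (Finset.mem_filter.1 he).1, fun e he f hf =>
        hM.2 e (Finset.mem_filter.1 he).1 f (Finset.mem_filter.1 hf).1⟩
    · rintro e he x ⟨y, rfl⟩
      simp only [Finset.mem_filter, Sym2.mem_iff, not_exists, not_and] at he
      exact hend x y he.1 (he.2 x (Or.inl rfl)) (he.2 y (Or.inr rfl))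
  have h6 := hd v
  omega

lemma exists_unused_class {k : ℕ} {U : Fin k → Set ℕ} (hU : ∀ i j, i ≠ j → Disjoint (U i) (U j))
    (h : (edges F).card < k) : ∃ i, ∀ f ∈ F.edgeSet, c f ∉ U i := by
  by_contra! hc
  choose φ hφ hφU using hc
  have hle := Finset.card_le_card_of_injOn (s := Finset.univ) (t := edges F) φ
    (fun i _ => by simpa using hφ i) (fun i _ j _ hij => by
      by_contra hne
      exact Set.disjoint_left.1 (hU i j hne) (hφU i) (hij ▸ hφU j))
  simp only [Finset.card_univ, Fintype.card_fin] at hle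
  omega

/-- A well-coloured graph of large minimum degree has a rainbow spanning tree of bounded maximum
degree. -/
lemma exists_lowForest_connected {α : ℝ} (hα : 0 < α) (hα' : α ≤ 1 / 2)
    (hn : 2500 ≤ α ^ 2 * (Fintype.card V : ℝ)) (hp : ProperColoring H c)
    (hw : WellColoured H c α)
    (hdeg : ∀ v, (1 - α / 15) * (Fintype.card V : ℝ) ≤ (deg H v : ℝ)) :
    ∃ T, LowForest H c ⌊50 / α⌋₊ T ∧ T.Connected := by
  by_contra! hno
  set n : ℝ := (Fintype.card V : ℝ) with hn_def
  have hαn : 5000 ≤ α * n := by nlinarith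
  have hn0 : 0 < n := by
    by_contra! h
    nlinarith
  have : Nonempty V := by
    rw [← Fintype.card_pos_iff]
    rw [hn_def] at hn0
    exact_mod_cast hn0
  obtain ⟨F, A, hE⟩ := exists_extremal hno
  set K := ⌊50 / α⌋₊ with hK
  have hKα : 49 / α ≤ (K : ℝ) - 1 := by
    have h1 := Nat.lt_floor_add_one (50 / α)
    have h2 : 2 ≤ 1 / α := by
      rw [le_div_iff₀ hα]
      linarith
    have h3 : 50 / α = 49 / α + 1 / α := by ring
    rw [← hK] at h1
    linarith
  have hK98 : (98 : ℝ) ≤ 49 / α := by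
    rw [le_div_iff₀ hα]
    linarith
  have hK3 : 3 ≤ K := by
    have : (3 : ℝ) ≤ K := by linarith
    exact_mod_cast this
  set S := saturated F K with hS
  have hSn : (S.card : ℝ) ≤ α * n / 20 := by
    have h1 := card_saturated_le (K := K) hE.forest.acyclic
    have h2 : (S.card : ℝ) * ((K : ℝ) - 1) ≤ 2 * n := by
      have : ((K - 1 : ℕ) : ℝ) = (K : ℝ) - 1 := by
        push_cast [Nat.cast_sub (show 1 ≤ K by omega)]
        ring
      rw [← this, hn_def]
      exact_mod_cast h1
    have h3 : (S.card : ℝ) * (49 / α) ≤ 2 * n :=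
      (mul_le_mul_of_nonneg_left hKα (Nat.cast_nonneg _)).trans h2
    rw [← mul_div_assoc, div_le_iff₀ hα] at h3
    nlinarith
  set d := ⌊α * n / 15⌋₊ with hd
  have hdn : (d : ℝ) ≤ α * n / 15 := Nat.floor_le (by positivity)
  have hdeg' : ∀ v, Fintype.card V ≤ deg H v + d := by
    intro v
    have h1 : Fintype.card V - deg H v ≤ d := by
      rw [hd]
      apply Nat.le_floor
      have := hdeg v
      rcases le_total (deg H v) (Fintype.card V) with h | h
      · rw [Nat.cast_sub h]
        linarith
      · rw [Nat.sub_eq_zero_of_le h, Nat.cast_zero]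
        positivity
    omega
  obtain ⟨U, hUd, hUr, -⟩ := hw
  obtain ⟨i, hi⟩ := exists_unused_class (c := c) (F := F) hUd
    (by have := hE.card_edges; omega)
  obtain ⟨M, hMH, hMU, hM, hMcard⟩ := hUr i
  have h1 := hE.card_new_matching_le hp hdeg' hK3 hM hMH
    (fun e he f hf hce => hi f hf (hce ▸ hMU e he))
  have h2 := hE.card_sdiff_saturated_le hp hdeg'
  have h3 : A.card ≤ (A \ S).card + S.card := by
    have := Finset.le_card_sdiff S A
    omega
  rw [← hS] at h1 h2
  have h4 : M.card ≤ 7 * S.card + 5 * d + 1 := by omega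
  have h5 : (M.card : ℝ) ≤ 7 * S.card + 5 * d + 1 := by exact_mod_cast h4
  linarith

lemma deg_eq_degree (F : SimpleGraph V) (v : V) : deg F v = F.degree v := by
  unfold deg
  rw [← SimpleGraph.card_neighborFinset_eq_degree]
  congr 1
  ext w
  simp

lemma deg_le_deg_deleteEdges_add {ι : Type*} [Fintype ι] (H : SimpleGraph V)
    (F : ι → SimpleGraph V) {K : ℕ} (hF : ∀ i v, deg (F i) v ≤ K) (v : V) :
    deg H v ≤ deg (H.deleteEdges (⋃ i, (F i ⊓ H).edgeSet)) v + Fintype.card ι * K := by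
  unfold deg
  have hsub : Finset.univ.filter (H.Adj v) ⊆
      Finset.univ.filter ((H.deleteEdges (⋃ i, (F i ⊓ H).edgeSet)).Adj v) ∪
        Finset.univ.biUnion fun i => Finset.univ.filter ((F i).Adj v) := by
    intro w hw
    simp only [Finset.mem_filter, Finset.mem_univ, true_and, Finset.mem_union,
      SimpleGraph.deleteEdges_adj, Set.mem_iUnion, Finset.mem_biUnion] at hw ⊢
    by_cases h : ∃ i, (F i).Adj v w
    · exact Or.inr h
    · refine Or.inl ⟨hw, fun ⟨i, hi⟩ => h ⟨i, ?_⟩⟩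
      exact (SimpleGraph.mem_edgeSet _ |>.1 hi).1
  refine (Finset.card_le_card hsub).trans ((Finset.card_union_le _ _).trans ?_)
  gcongr
  exact Finset.card_biUnion_le_card_mul _ _ _ fun i _ => hF i v

end RainbowTrees

open RainbowTrees

theorem stmt7 {V : Type*} [Fintype V] [DecidableEq V] (G : SimpleGraph V)
    (c : Sym2 V → ℕ) (α : ℝ) (hα : 0 < α) (hα' : α ≤ 1 / 2) (ℓ : ℕ)
    (hℓ : (ℓ : ℝ) ≤ α ^ 2 * (Fintype.card V : ℝ) / 2500)
    (hproper : ProperColoring G c)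
    (Gs : Fin ℓ → SimpleGraph V) (hsub : ∀ i, Gs i ≤ G)
    (hrobust : ∀ i, RobustlyColoured (Gs i) c α ℓ)
    (hdeg : ∀ i, ∀ v : V,
      (1 - α / 30) * (Fintype.card V : ℝ) ≤ ((Gs i).degree v : ℝ)) :
    ∃ T : Fin ℓ → SimpleGraph V,
      (∀ i, T i ≤ Gs i ∧ (T i).IsTree ∧ IsRainbow c (T i).edgeSet) ∧
      (∀ i j, i ≠ j → Disjoint ((T i).edgeSet) ((T j).edgeSet)) := by
  rcases Nat.eq_zero_or_pos ℓ with rfl | hpos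
  · exact ⟨fun _ => ⊥, fun i => i.elim0, fun i => i.elim0⟩
  have hℓ1 : (1 : ℝ) ≤ ℓ := by exact_mod_cast hpos
  set K := ⌊50 / α⌋₊ with hK
  have hKα : (K : ℝ) ≤ 50 / α := Nat.floor_le (by positivity)
  have hℓK : (ℓ : ℝ) * K ≤ α * (Fintype.card V : ℝ) / 50 := by
    calc (ℓ : ℝ) * K ≤ (α ^ 2 * (Fintype.card V : ℝ) / 2500) * (50 / α) := by gcongr
      _ = α * (Fintype.card V : ℝ) / 50 := by
        field_simp
        ring
  have key : ∀ k ≤ ℓ, ∃ T : Fin ℓ → SimpleGraph V,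
      (∀ i, i.val < k → T i ≤ Gs i ∧ (T i).IsTree) ∧
      (∀ i, (T i).IsAcyclic ∧ IsRainbow c (T i).edgeSet ∧ ∀ v, deg (T i) v ≤ K) ∧
      (∀ i j, i ≠ j → Disjoint ((T i).edgeSet) ((T j).edgeSet)) := by
    intro k hk
    induction k with
    | zero =>
      exact ⟨fun _ => ⊥, fun i hi => absurd hi (Nat.not_lt_zero _),
        fun i => ⟨SimpleGraph.isAcyclic_bot, by simp [IsRainbow], by simp [deg]⟩, by simp⟩
    | succ k ih =>
      obtain ⟨T, hT, hTlow, hTdisj⟩ := ih (by omega)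
      let m : Fin ℓ := ⟨k, hk⟩
      set H := (Gs m).deleteEdges (⋃ i, (T i ⊓ Gs m).edgeSet) with hH
      have hHG : H ≤ Gs m := SimpleGraph.deleteEdges_le _
      have hwell : WellColoured H c α := hrobust m (fun i => T i ⊓ Gs m) fun i =>
        ⟨inf_le_right, (hTlow i).1.anti inf_le_left,
          (hTlow i).2.1.mono (SimpleGraph.edgeSet_mono inf_le_left)⟩
      obtain ⟨T', hT', hconn⟩ := exists_lowForest_connected (H := H) (c := c) hα hα'
        (by linarith)
        (fun a b b' hb hb' => hproper (hsub m (hHG hb)) (hsub m (hHG hb'))) hwell (by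
          intro v
          have h1 := deg_le_deg_deleteEdges_add (Gs m) T (fun i => (hTlow i).2.2) v
          rw [← hH, Fintype.card_fin] at h1
          have h2 : (deg (Gs m) v : ℝ) ≤ deg H v + ℓ * K := by exact_mod_cast h1
          have h3 : (1 - α / 30) * (Fintype.card V : ℝ) ≤ (deg (Gs m) v : ℝ) := by
            rw [deg_eq_degree]
            convert hdeg m v
          have h4 : 0 ≤ α * (Fintype.card V : ℝ) := by positivity
          nlinarith)
      have hdisj : ∀ i, Disjoint (T i).edgeSet T'.edgeSet := by
        intro i
        rw [Set.disjoint_left]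
        intro e he he'
        have heH := SimpleGraph.edgeSet_mono hT'.le he'
        rw [hH, SimpleGraph.edgeSet_deleteEdges] at heH
        refine heH.2 (Set.mem_iUnion.2 ⟨i, ?_⟩)
        rw [SimpleGraph.edgeSet_inf]
        exact ⟨he, heH.1⟩
      refine ⟨Function.update T m T', ?_, ?_, ?_⟩
      · intro i hi
        by_cases him : i = m
        · subst him
          rw [Function.update_self]
          exact ⟨hT'.le.trans hHG, hconn, hT'.acyclic⟩
        · rw [Function.update_of_ne him]
          exact hT i (lt_of_le_of_ne (Nat.lt_succ_iff.1 hi) fun h => him (Fin.ext h))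
      · intro i
        by_cases him : i = m
        · subst him
          rw [Function.update_self]
          exact ⟨hT'.acyclic, hT'.rainbow, hT'.deg_le⟩
        · rw [Function.update_of_ne him]
          exact hTlow i
      · intro i j hij
        by_cases him : i = m
        · subst him
          rw [Function.update_self, Function.update_of_ne hij.symm]
          exact (hdisj j).symm
        · rw [Function.update_of_ne him]
          by_cases hjm : j = m
          · subst hjm
            rw [Function.update_self]
            exact hdisj i
          · rw [Function.update_of_ne hjm]
            exact hTdisj i j hij
  obtain ⟨T, hT, hlow, hdisj⟩ := key ℓ le_rfl
  exact ⟨T, fun i => ⟨(hT i i.isLt).1, (hT i i.isLt).2, (hlow i).2.1⟩, hdisj⟩
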